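/- arXiv:1603.00783 — 3 statements merged into one kernel-verified Lean document; each statement's English description precedes it below -/
import Mathlib

section
/- Let b ∈ (0, 1/2]. There exists a constant C_b > 0 such that for every t > 0 and every x ≠ 0, the Stein derivative of the function y ↦ e^{i t / y} satisfies 𝒟^b(e^{it/(·)})(x) ≤ C_b t^b / |x|^{2b}. -/
open MeasureTheory

/-- The Stein derivative of order `b` of a function `f : ℝ → ℂ`. -/
noncomputable def steinDeriv (b : ℝ) (f : ℝ → ℂ) (x : ℝ) : ℝ :=
  (∫ y : ℝ, ‖f x - f y‖ ^ 2 / |x - y| ^ (1 + 2 * b)) ^ ((1 : ℝ) / 2)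

theorem norm_exp_I_mul_sub_exp_I_mul_le_abs_sub (u v : ℝ) :
    ‖Complex.exp (Complex.I * (u : ℂ)) - Complex.exp (Complex.I * (v : ℂ))‖ ≤ |u - v| := by
  have h : Complex.exp (Complex.I * (u : ℂ)) - Complex.exp (Complex.I * (v : ℂ)) =
      Complex.exp (Complex.I * (v : ℂ)) * (Complex.exp (Complex.I * ((u - v : ℝ) : ℂ)) - 1) := by
    rw [mul_sub, ← Complex.exp_add]
    push_cast
    ring_nf
  rw [h, norm_mul, Complex.norm_exp_I_mul_ofReal, one_mul]
  exact Real.norm_exp_I_mul_ofReal_sub_one_le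

theorem norm_exp_I_mul_sub_exp_I_mul_le_two (u v : ℝ) :
    ‖Complex.exp (Complex.I * (u : ℂ)) - Complex.exp (Complex.I * (v : ℂ))‖ ≤ 2 := by
  refine (norm_sub_le _ _).trans ?_
  rw [Complex.norm_exp_I_mul_ofReal, Complex.norm_exp_I_mul_ofReal]
  norm_num

theorem integrable_min_one_sq_div_abs_rpow {p : ℝ} (hp₁ : 1 < p) (hp₃ : p < 3) :
    Integrable fun u : ℝ => min 1 (u ^ 2) / |u| ^ p := by
  have h_Ioi : IntegrableOn (fun u : ℝ => min 1 (u ^ 2) / |u| ^ p) (Set.Ioi 0) := by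
    rw [← Set.Ioc_union_Ioi_eq_Ioi (zero_le_one' ℝ)]
    refine IntegrableOn.union ?_ ?_
    · have h : IntegrableOn (fun u : ℝ => u ^ (2 - p)) (Set.Ioc 0 1) :=
        (intervalIntegral.intervalIntegrable_rpow' (by linarith)).1
      refine h.congr_fun (fun u hu => ?_) measurableSet_Ioc
      have hu₂ : u ^ 2 ≤ 1 := pow_le_one₀ hu.1.le hu.2
      simp only [min_eq_right hu₂, abs_of_pos hu.1]
      rw [Real.rpow_sub hu.1, Real.rpow_two]
    · refine (integrableOn_Ioi_rpow_of_lt (a := -p) (by linarith) zero_lt_one).congr_fun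
        (fun u hu => ?_) measurableSet_Ioi
      have hu₁ : (1 : ℝ) < u := hu
      have hu₂ : 1 ≤ u ^ 2 := one_le_pow₀ hu₁.le
      simp only [min_eq_left hu₂, abs_of_pos (zero_lt_one.trans hu₁)]
      rw [Real.rpow_neg (by linarith), one_div]
  rw [← integrableOn_univ, ← Set.Iic_union_Ioi (a := (0 : ℝ))]
  refine IntegrableOn.union ?_ h_Ioi
  have h_neg : MeasurableEmbedding fun u : ℝ => -u := (Homeomorph.neg ℝ).measurableEmbedding
  rw [← Measure.map_neg_eq_self (volume : Measure ℝ), h_neg.integrableOn_map_iff]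
  simpa [Function.comp_def, integrableOn_Ici_iff_integrableOn_Ioi] using h_Ioi

/-- Where `y` is comparable to `x` or larger, the phase `t / y` is Lipschitz with constant
`2 * (t / x ^ 2)`. -/
theorem norm_sq_exp_inv_sub_le_of_le {t x y : ℝ} (ht : 0 < t) (hx : x ≠ 0) (hy : |x| / 2 ≤ |y|) :
    ‖Complex.exp (Complex.I * ((t / x : ℝ) : ℂ)) - Complex.exp (Complex.I * ((t / y : ℝ) : ℂ))‖ ^ 2
      ≤ 4 * min 1 ((t / x ^ 2 * (x - y)) ^ 2) := by
  have hx₀ : 0 < |x| := abs_pos.2 hx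
  have hy₀ : 0 < |y| := by linarith
  have hy' : y ≠ 0 := abs_pos.1 hy₀
  have h₁ := norm_exp_I_mul_sub_exp_I_mul_le_abs_sub (t / x) (t / y)
  have h₂ := norm_exp_I_mul_sub_exp_I_mul_le_two (t / x) (t / y)
  have h₃ : |t / x - t / y| ≤ 2 * |t / x ^ 2 * (x - y)| := by
    have e : t / x - t / y = t * (y - x) / (x * y) := by field_simp
    rw [e, abs_div, abs_mul, abs_mul, abs_mul, abs_div, abs_pow, abs_of_pos ht, abs_sub_comm y x,
      div_le_iff₀ (by positivity)]
    have e₂ : 2 * (t / |x| ^ 2 * |x - y|) * (|x| * |y|) = t * |x - y| * (|y| / (|x| / 2)) := by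
      field_simp
    rw [e₂]
    exact le_mul_of_one_le_right (by positivity) ((one_le_div (by positivity)).2 hy)
  rw [mul_min_of_nonneg _ _ (by norm_num : (0 : ℝ) ≤ 4)]
  refine le_min ?_ ?_
  · nlinarith [norm_nonneg (Complex.exp (Complex.I * ((t / x : ℝ) : ℂ)) -
      Complex.exp (Complex.I * ((t / y : ℝ) : ℂ)))]
  · refine (pow_le_pow_left₀ (norm_nonneg _) (h₁.trans h₃) 2).trans_eq ?_
    rw [mul_pow, sq_abs]
    norm_num

theorem norm_sq_exp_inv_sub_le_of_lt {t x y : ℝ} (ht : 0 < t) (hx : x ≠ 0) (hy : |y| < |x| / 2) :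
    ‖Complex.exp (Complex.I * ((t / x : ℝ) : ℂ)) - Complex.exp (Complex.I * ((t / y : ℝ) : ℂ))‖ ^ 2
      ≤ 8 * (1 + (y / min t |x|) ^ 2)⁻¹ := by
  have hx₀ : 0 < |x| := abs_pos.2 hx
  have h₁ := norm_exp_I_mul_sub_exp_I_mul_le_abs_sub (t / x) (t / y)
  have h₂ := norm_exp_I_mul_sub_exp_I_mul_le_two (t / x) (t / y)
  set N := ‖Complex.exp (Complex.I * ((t / x : ℝ) : ℂ)) -
    Complex.exp (Complex.I * ((t / y : ℝ) : ℂ))‖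
  have hN : 0 ≤ N := norm_nonneg _
  have hN₄ : N ^ 2 ≤ 4 := by nlinarith
  rw [← div_eq_mul_inv, le_div_iff₀ (by positivity)]
  suffices h : N ^ 2 * (y / min t |x|) ^ 2 ≤ 4 by linarith
  rw [← mul_pow, ← sq_abs, abs_mul, abs_of_nonneg hN, abs_div]
  suffices h : N * (|y| / |(min t |x|)|) ≤ 2 by
    have h₀ : 0 ≤ N * (|y| / |(min t |x|)|) := by positivity
    nlinarith
  rcases le_total t |x| with htx | htx
  · rw [min_eq_left htx, abs_of_pos ht]
    rcases eq_or_ne y 0 with rfl | hy'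
    · simp
    have hy₀ : 0 < |y| := abs_pos.2 hy'
    refine (mul_le_mul_of_nonneg_right h₁ (by positivity)).trans ?_
    have e : |t / x - t / y| * (|y| / t) = |y - x| / |x| := by
      have e' : t / x - t / y = t * (y - x) / (x * y) := by field_simp
      rw [e', abs_div, abs_mul, abs_mul, abs_of_pos ht]
      field_simp
    rw [e, div_le_iff₀ hx₀]
    linarith [abs_sub y x]
  · rw [min_eq_right htx, abs_abs]
    have h : |y| / |x| ≤ 1 := (div_le_one hx₀).2 (by linarith)
    exact (mul_le_of_le_one_right hN h).trans h₂

/-- An integrable majorant of the integrand of the Stein derivative of `y ↦ exp (I * t / y)`. -/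
theorem stein_integrand_exp_inv_le {b t x : ℝ} (hb₀ : 0 < b) (hb : b ≤ 1 / 2) (ht : 0 < t)
    (hx : x ≠ 0) (y : ℝ) :
    ‖Complex.exp (Complex.I * ((t / x : ℝ) : ℂ)) -
      Complex.exp (Complex.I * ((t / y : ℝ) : ℂ))‖ ^ 2 / |x - y| ^ (1 + 2 * b) ≤
      4 * (t / x ^ 2) ^ (1 + 2 * b) * (min 1 ((t / x ^ 2 * (x - y)) ^ 2) /
        |t / x ^ 2 * (x - y)| ^ (1 + 2 * b)) +
      32 / |x| ^ (1 + 2 * b) * (1 + (y / min t |x|) ^ 2)⁻¹ := by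
  have hx₀ : 0 < |x| := abs_pos.2 hx
  have hc : 0 < t / x ^ 2 := by positivity
  rcases le_or_gt (|x| / 2) |y| with hy | hy
  · refine le_add_of_le_of_nonneg ?_ (by positivity)
    have hcp : (t / x ^ 2) ^ (1 + 2 * b) ≠ 0 := (Real.rpow_pos_of_pos hc _).ne'
    have e : 4 * (t / x ^ 2) ^ (1 + 2 * b) * (min 1 ((t / x ^ 2 * (x - y)) ^ 2) /
        |t / x ^ 2 * (x - y)| ^ (1 + 2 * b)) =
        4 * min 1 ((t / x ^ 2 * (x - y)) ^ 2) / |x - y| ^ (1 + 2 * b) := by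
      rw [abs_mul, abs_of_pos hc, Real.mul_rpow hc.le (abs_nonneg _)]
      generalize min 1 ((t / x ^ 2 * (x - y)) ^ 2) = m
      generalize (t / x ^ 2) ^ (1 + 2 * b) = q at hcp
      rw [mul_div_assoc', mul_assoc, mul_left_comm, mul_div_mul_left _ _ hcp]
    rw [e]
    exact div_le_div_of_nonneg_right (norm_sq_exp_inv_sub_le_of_le ht hx hy) (by positivity)
  · refine le_add_of_nonneg_of_le (by positivity) ?_
    have hxy : |x| / 2 ≤ |x - y| := by linarith [abs_sub_abs_le_abs_sub x y]
    have hpow : |x| ^ (1 + 2 * b) / 4 ≤ |x - y| ^ (1 + 2 * b) := by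
      refine le_trans ?_ (Real.rpow_le_rpow (by positivity) hxy (by linarith))
      rw [Real.div_rpow hx₀.le (by norm_num)]
      refine div_le_div_of_nonneg_left (by positivity) (by positivity) ?_
      calc (2 : ℝ) ^ (1 + 2 * b) ≤ 2 ^ (2 : ℝ) :=
            Real.rpow_le_rpow_of_exponent_le (by norm_num) (by linarith)
        _ = 4 := by norm_num
    have hp : 0 < |x| ^ (1 + 2 * b) := by positivity
    refine (div_le_div₀ (by positivity) (norm_sq_exp_inv_sub_le_of_lt ht hx hy)
      (by positivity) hpow).trans_eq ?_
    field_simp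
    norm_num

theorem min_div_rpow_le {b t a : ℝ} (hb₀ : 0 < b) (hb : b ≤ 1 / 2) (ht : 0 < t) (ha : 0 < a) :
    min t a / a ^ (1 + 2 * b) ≤ (t / a ^ 2) ^ (2 * b) := by
  have hr : 0 < min t a := lt_min ht ha
  have h : min t a ≤ t ^ (2 * b) * a ^ (1 - 2 * b) := by
    calc min t a = min t a ^ (2 * b) * min t a ^ (1 - 2 * b) := by
          rw [← Real.rpow_add hr]; simp
      _ ≤ _ := mul_le_mul (Real.rpow_le_rpow hr.le (min_le_left _ _) (by linarith))
          (Real.rpow_le_rpow hr.le (min_le_right _ _) (by linarith)) (by positivity) (by positivity)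
  rw [div_le_iff₀ (by positivity)]
  refine h.trans_eq ?_
  rw [Real.div_rpow ht.le (by positivity), div_mul_eq_mul_div, mul_div_assoc,
    ← Real.rpow_natCast a 2, ← Real.rpow_mul ha.le, ← Real.rpow_sub ha]
  congr 2
  push_cast
  ring

theorem stein_deriv_exp_inv_bound (b : ℝ) (hb : b ∈ Set.Ioc (0 : ℝ) (1 / 2)) :
    ∃ C : ℝ, 0 < C ∧ ∀ t : ℝ, 0 < t → ∀ x : ℝ, x ≠ 0 →
      steinDeriv b (fun y : ℝ => Complex.exp (Complex.I * ((t / y : ℝ) : ℂ))) x ≤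
        C * t ^ b / |x| ^ (2 * b) := by
  obtain ⟨hb₀, hb₁⟩ := hb
  set g : ℝ → ℝ := fun u => min 1 (u ^ 2) / |u| ^ (1 + 2 * b)
  have hg_int : Integrable g :=
    integrable_min_one_sq_div_abs_rpow (by linarith) (by linarith)
  set K : ℝ := ∫ u, g u with hK
  have hK₀ : 0 ≤ K := integral_nonneg fun u => by positivity
  have hM : 0 < 4 * K + 32 * Real.pi := by positivity
  refine ⟨(4 * K + 32 * Real.pi) ^ ((1 : ℝ) / 2), by positivity, fun t ht x hx => ?_⟩
  have hx₀ : 0 < |x| := abs_pos.2 hx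
  have hr : 0 < min t |x| := lt_min ht hx₀
  set c : ℝ := t / x ^ 2 with hc_def
  have hc : 0 < c := by positivity
  have hG₁ : Integrable fun y => 4 * c ^ (1 + 2 * b) * g (c * (x - y)) :=
    ((hg_int.comp_mul_left' hc.ne').comp_sub_left x).const_mul _
  have hG₂ : Integrable fun y : ℝ =>
      32 / |x| ^ (1 + 2 * b) * (1 + (y / min t |x|) ^ 2)⁻¹ :=
    (integrable_inv_one_add_sq.comp_div hr.ne').const_mul _
  have hI₁ : ∫ y, 4 * c ^ (1 + 2 * b) * g (c * (x - y)) = 4 * K * c ^ (2 * b) := by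
    rw [integral_const_mul, integral_sub_left_eq_self (fun y => g (c * y)) volume x,
      Measure.integral_comp_mul_left, smul_eq_mul, ← hK, abs_of_pos (inv_pos.2 hc),
      Real.rpow_add hc, Real.rpow_one]
    field_simp
  have hI₂ : ∫ y : ℝ, 32 / |x| ^ (1 + 2 * b) * (1 + (y / min t |x|) ^ 2)⁻¹ ≤
      32 * Real.pi * c ^ (2 * b) := by
    rw [integral_const_mul, Measure.integral_comp_div (fun y : ℝ => (1 + y ^ 2)⁻¹),
      integral_univ_inv_one_add_sq, smul_eq_mul, abs_of_pos hr, hc_def, ← sq_abs x]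
    refine le_trans (le_of_eq ?_) (mul_le_mul_of_nonneg_left
      (min_div_rpow_le hb₀ hb₁ ht hx₀) (by positivity))
    ring
  have hmain : ∫ y : ℝ, ‖Complex.exp (Complex.I * ((t / x : ℝ) : ℂ)) -
      Complex.exp (Complex.I * ((t / y : ℝ) : ℂ))‖ ^ 2 / |x - y| ^ (1 + 2 * b) ≤
      (4 * K + 32 * Real.pi) * c ^ (2 * b) := by
    refine (integral_mono_of_nonneg (Filter.Eventually.of_forall fun y => by positivity)
      (hG₁.add hG₂) (Filter.Eventually.of_forall
        (stein_integrand_exp_inv_le hb₀ hb₁ ht hx))).trans ?_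
    simp only [Pi.add_apply]
    rw [integral_add hG₁ hG₂, hI₁, add_mul]
    gcongr
  unfold steinDeriv
  refine (Real.rpow_le_rpow (integral_nonneg fun y => by positivity) hmain
    (by norm_num)).trans_eq ?_
  rw [Real.mul_rpow hM.le (by positivity), ← Real.rpow_mul hc.le, mul_div_assoc, hc_def,
    Real.div_rpow ht.le (by positivity), ← sq_abs x, ← Real.rpow_natCast |x| 2,
    ← Real.rpow_mul hx₀.le]
  congr 3 <;> push_cast <;> ring_nf
end

section
/- Let b ∈ (0, 1). There exists a constant C_b > 0 such that for every t > 0 and every x ≠ 0 with t^{1/3}|x| > t^{−1/3} x^{−2}, one has ( ∫_{{w : |w| < (t^{1/3} x²)^{−1}}} |e^{i(−3x²t^{2/3}w + 3x t^{1/3} w² − w³)} − 1|² / |w|^{1+2b} dw )^{1/2} ≤ C_b t^{1/3 + b/3} |x|^{2b}. -/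
open MeasureTheory

/-- The phase `−3x²t^{2/3}w + 3xt^{1/3}w² − w³` arising from the change of variables
`w = t^{1/3}(x − y)` in the Stein derivative of `y ↦ e^{ity³}`. -/
noncomputable def cubicPhase (t x w : ℝ) : ℝ :=
  -3 * x ^ 2 * t ^ ((2 : ℝ) / 3) * w + 3 * x * t ^ ((1 : ℝ) / 3) * w ^ 2 - w ^ 3

open Set

lemma abs_cubicPhase_le {t x w : ℝ} (ht : 0 < t) (hw : |w| ≤ t ^ ((1 : ℝ) / 3) * |x|) :
    |cubicPhase t x w| ≤ 7 * (t ^ ((1 : ℝ) / 3) * |x|) ^ 2 * |w| := by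
  have h2 : t ^ ((2 : ℝ) / 3) = (t ^ ((1 : ℝ) / 3)) ^ 2 := by
    rw [← Real.rpow_natCast, ← Real.rpow_mul ht.le]; norm_num
  have hs : 0 < t ^ ((1 : ℝ) / 3) := by positivity
  unfold cubicPhase
  rw [h2]
  generalize t ^ ((1 : ℝ) / 3) = s at *
  have hx := abs_nonneg x
  have hw0 := abs_nonneg w
  calc |-3 * x ^ 2 * s ^ 2 * w + 3 * x * s * w ^ 2 - w ^ 3|
      ≤ |-3 * x ^ 2 * s ^ 2 * w| + |3 * x * s * w ^ 2| + |w ^ 3| :=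
        (abs_sub _ _).trans (by gcongr; exact abs_add_le _ _)
    _ = 3 * (s * |x|) ^ 2 * |w| + 3 * (s * |x|) * |w| * |w| + |w| * |w| * |w| := by
        simp only [abs_mul, abs_pow, abs_of_pos hs, abs_neg, Nat.abs_ofNat]; ring
    _ ≤ 3 * (s * |x|) ^ 2 * |w| + 3 * (s * |x|) * (s * |x|) * |w|
          + (s * |x|) * (s * |x|) * |w| := by gcongr
    _ = _ := by ring

lemma integral_abs_rpow {r : ℝ} (hr : -1 < r) {R : ℝ} (hR : 0 ≤ R) :
    ∫ w in {w : ℝ | |w| < R}, |w| ^ r = 2 * (R ^ (r + 1) / (r + 1)) := by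
  have hm : MeasurableSet {w : ℝ | |w| < R} := measurableSet_lt (by fun_prop) (by fun_prop)
  have h := integral_comp_abs (f := (Iio R).indicator fun y : ℝ => y ^ r)
  have h1 : ∫ w in {w : ℝ | |w| < R}, |w| ^ r =
      ∫ w : ℝ, (Iio R).indicator (fun y : ℝ => y ^ r) |w| := by
    rw [← integral_indicator hm]; rfl
  rw [h1, h, setIntegral_indicator measurableSet_Iio, Ioi_inter_Iio, ← integral_Ioc_eq_integral_Ioo,
    ← intervalIntegral.integral_of_le hR, integral_rpow (Or.inl hr),
    Real.zero_rpow (by linarith), sub_zero]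

lemma integrableOn_abs_rpow {r : ℝ} (hr : -1 < r) {R : ℝ} (hR : 0 < R) :
    IntegrableOn (fun w : ℝ => |w| ^ r) {w | |w| < R} := by
  refine Integrable.of_integral_ne_zero ?_
  rw [integral_abs_rpow hr hR.le]
  have : 0 < r + 1 := by linarith
  positivity

theorem cubic_phase_integral_small_w_case2 (b : ℝ) (hb : b ∈ Set.Ioo (0 : ℝ) 1) :
    ∃ C : ℝ, 0 < C ∧ ∀ t : ℝ, 0 < t → ∀ x : ℝ, x ≠ 0 →
      t ^ (-(1 : ℝ) / 3) / x ^ 2 < t ^ ((1 : ℝ) / 3) * |x| →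
      (∫ w in {w : ℝ | |w| < (t ^ ((1 : ℝ) / 3) * x ^ 2)⁻¹},
          ‖Complex.exp (Complex.I * ((cubicPhase t x w : ℝ) : ℂ)) - 1‖ ^ 2 /
            |w| ^ (1 + 2 * b)) ^ ((1 : ℝ) / 2) ≤ C * t ^ (1 / 3 + b / 3) * |x| ^ (2 * b) := by
  obtain ⟨hb0, hb1⟩ := hb
  have hb' : 0 < 1 - b := by linarith
  refine ⟨7 / √(1 - b), by positivity, fun t ht x hx hlt => ?_⟩
  have hRlt : (t ^ ((1 : ℝ) / 3) * x ^ 2)⁻¹ < t ^ ((1 : ℝ) / 3) * |x| := by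
    rwa [mul_inv, ← Real.rpow_neg ht.le, ← div_eq_mul_inv, ← neg_div]
  have hs : 0 < t ^ ((1 : ℝ) / 3) := by positivity
  have hts : t ^ (1 / 3 + b / 3) = (t ^ ((1 : ℝ) / 3)) ^ (1 + b) := by
    rw [← Real.rpow_mul ht.le]; congr 1; ring
  have hphase := fun w => abs_cubicPhase_le (t := t) (x := x) (w := w) ht
  rw [hts]
  generalize t ^ ((1 : ℝ) / 3) = s at *
  have hx' : 0 < |x| := abs_pos.mpr hx
  set R := (s * x ^ 2)⁻¹ with hRdef
  have hR : 0 < R := by positivity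
  have hm : MeasurableSet {w : ℝ | |w| < R} := measurableSet_lt (by fun_prop) (by fun_prop)
  have hpow : ((s * |x|) ^ 2 * R ^ (1 - b)) = s ^ (1 + b) * |x| ^ (2 * b) := by
    have : R ^ (1 - b) = s ^ (b - 1) * |x| ^ (2 * b - 2) := by
      rw [hRdef, Real.inv_rpow (by positivity), ← Real.rpow_neg (by positivity), ← sq_abs x,
        Real.mul_rpow hs.le (by positivity), ← Real.rpow_natCast |x|, ← Real.rpow_mul hx'.le]
      congr 2 <;> push_cast <;> ring
    rw [this, mul_pow, ← Real.rpow_natCast s, ← Real.rpow_natCast |x|, mul_mul_mul_comm,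
      ← Real.rpow_add hs, ← Real.rpow_add hx']
    congr 2 <;> push_cast <;> ring
  have hint : ∫ w in {w : ℝ | |w| < R},
      ‖Complex.exp (Complex.I * ((cubicPhase t x w : ℝ) : ℂ)) - 1‖ ^ 2 / |w| ^ (1 + 2 * b) ≤
      ∫ w in {w : ℝ | |w| < R}, (7 * (s * |x|) ^ 2) ^ 2 * |w| ^ (1 - 2 * b) := by
    refine integral_mono_of_nonneg (.of_forall fun w => by positivity)
      ((integrableOn_abs_rpow (by linarith) hR).const_mul _) ?_
    filter_upwards [ae_restrict_mem hm] with w hw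
    rcases eq_or_ne w 0 with rfl | hw0
    · have : cubicPhase t x 0 = 0 := by simp [cubicPhase]
      simp only [this, Complex.ofReal_zero, mul_zero, Complex.exp_zero, sub_self, norm_zero]
      simp only [ne_eq, OfNat.ofNat_ne_zero, not_false_eq_true, zero_pow, zero_div]
      positivity
    have hw' : 0 < |w| := abs_pos.mpr hw0
    have hle := (Real.norm_exp_I_mul_ofReal_sub_one_le (x := cubicPhase t x w)).trans
      (hphase w ((le_of_lt hw).trans hRlt.le))
    rw [div_le_iff₀ (by positivity), mul_assoc, ← Real.rpow_add hw',
      show 1 - 2 * b + (1 + 2 * b) = ((2 : ℕ) : ℝ) by push_cast; ring, Real.rpow_natCast, ← mul_pow]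
    gcongr
  rw [integral_const_mul, integral_abs_rpow (by linarith) hR.le] at hint
  have hval : (7 * (s * |x|) ^ 2) ^ 2 * (2 * (R ^ (1 - 2 * b + 1) / (1 - 2 * b + 1))) =
      (7 / √(1 - b) * s ^ (1 + b) * |x| ^ (2 * b)) ^ 2 := by
    rw [mul_assoc (7 / √(1 - b)), ← hpow, mul_pow (7 / _), div_pow, Real.sq_sqrt hb'.le,
      mul_pow _ (R ^ _), ← Real.rpow_mul_natCast hR.le,
      show 1 - 2 * b + 1 = 2 * (1 - b) by ring, show (1 - b) * ((2 : ℕ) : ℝ) = 2 * (1 - b) by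
        push_cast; ring]
    field_simp
  rw [← Real.sqrt_eq_rpow]
  exact Real.sqrt_le_iff.mpr ⟨by positivity, hint.trans_eq hval⟩
end

section
/- Let b ∈ (0, 1/2]. There exists a constant C_b > 0 such that for every x > 0 and every t with 0 < t/x ≤ 6π, setting f(w) := (t/x) · w/(w − x), one has ( ∫_{{w : w ≤ −x/2}} |e^{i f(w)} − 1|² / |w|^{1+2b} dw )^{1/2} ≤ C_b t^b / x^{2b}. -/
open MeasureTheory

/-- The phase `f(w) = (t/x) · w/(w − x)` arising from the change of variables `w = x − y`
in the Stein derivative of `y ↦ e^{−it/y}`. -/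
noncomputable def mobiusPhase (t x w : ℝ) : ℝ := t / x * (w / (w - x))

lemma integrableOn_Iic_neg_abs_rpow {a c : ℝ} (ha : a < -1) (hc : 0 < c) :
    IntegrableOn (fun w : ℝ => |w| ^ a) (Set.Iic (-c)) := by
  have h : IntegrableOn (fun w : ℝ => |w| ^ a) (Set.Ioi c) :=
    (integrableOn_Ioi_rpow_of_lt ha hc).congr_fun
      (fun w hw => by simp only [abs_of_pos (hc.trans hw)]) measurableSet_Ioi
  rw [← integrableOn_Ici_iff_integrableOn_Ioi, ← neg_neg c] at h
  simpa only [abs_neg] using h.comp_neg_Iic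

lemma integral_Iic_neg_abs_rpow {a c : ℝ} (ha : a < -1) (hc : 0 < c) :
    ∫ w in Set.Iic (-c), |w| ^ a = -c ^ (a + 1) / (a + 1) := by
  have h := integral_comp_neg_Iic (-c) (fun w : ℝ => |w| ^ a)
  simp only [abs_neg, neg_neg] at h
  rw [h, ← integral_Ioi_rpow_of_lt ha hc]
  exact setIntegral_congr_fun measurableSet_Ioi
    fun w hw => by simp only [abs_of_pos (hc.trans hw)]

lemma abs_mobiusPhase_le {t x w : ℝ} (hx : 0 < x) (hs : 0 < t / x) (hw : w ≤ 0) :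
    |mobiusPhase t x w| ≤ t / x := by
  have hwx : w - x < 0 := by linarith
  have h0 : 0 ≤ w / (w - x) := div_nonneg_of_nonpos hw hwx.le
  have h1 : w / (w - x) ≤ 1 := (div_le_one_of_neg hwx).mpr (by linarith)
  rw [mobiusPhase, abs_of_nonneg (mul_nonneg hs.le h0)]
  exact mul_le_of_le_one_right hs.le h1

theorem mobius_phase_integral_E2 (b : ℝ) (hb : b ∈ Set.Ioc (0 : ℝ) (1 / 2)) :
    ∃ C : ℝ, 0 < C ∧ ∀ x : ℝ, 0 < x → ∀ t : ℝ, 0 < t / x → t / x ≤ 6 * Real.pi →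
      (∫ w in {w : ℝ | w ≤ -x / 2},
          ‖Complex.exp (Complex.I * ((mobiusPhase t x w : ℝ) : ℂ)) - 1‖ ^ 2 /
            |w| ^ (1 + 2 * b)) ^ ((1 : ℝ) / 2) ≤ C * t ^ b / x ^ (2 * b) := by
  obtain ⟨hb0, hb1⟩ := hb
  have hpi := Real.pi_pos
  set K : ℝ := (6 * Real.pi) ^ (2 - 2 * b) * (2 ^ (2 * b) / (2 * b)) with hK
  have hKpos : 0 < K := by positivity
  refine ⟨√K, Real.sqrt_pos.mpr hKpos, fun x hx t hs hs6 => ?_⟩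
  have ht : 0 < t := (div_pos_iff_of_pos_right hx).mp hs
  have ha : -(1 + 2 * b) < -1 := by linarith
  have hx2 : 0 < x / 2 := by positivity
  have hset : {w : ℝ | w ≤ -x / 2} = Set.Iic (-(x / 2)) := by
    rw [← neg_div]; rfl
  have hphase : (t / x) ^ 2 ≤ (6 * Real.pi) ^ (2 - 2 * b) * (t / x) ^ (2 * b) := by
    calc (t / x) ^ 2 = (t / x) ^ (2 - 2 * b) * (t / x) ^ (2 * b) := by
          rw [← Real.rpow_add hs, sub_add_cancel, Real.rpow_two]
      _ ≤ _ := by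
          gcongr
          linarith
  have hint : ∫ w in Set.Iic (-(x / 2)),
      ‖Complex.exp (Complex.I * ((mobiusPhase t x w : ℝ) : ℂ)) - 1‖ ^ 2 / |w| ^ (1 + 2 * b)
      ≤ ∫ w in Set.Iic (-(x / 2)), (t / x) ^ 2 * |w| ^ (-(1 + 2 * b)) := by
    refine integral_mono_of_nonneg (ae_of_all _ fun w => by positivity)
      ((integrableOn_Iic_neg_abs_rpow ha hx2).const_mul _) ?_
    filter_upwards [ae_restrict_mem measurableSet_Iic] with w hw
    have hw' : w ≤ -(x / 2) := hw
    rw [Real.rpow_neg (abs_nonneg w), ← div_eq_mul_inv]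
    gcongr
    calc _ ≤ ‖mobiusPhase t x w‖ := Real.norm_exp_I_mul_ofReal_sub_one_le
      _ ≤ t / x := abs_mobiusPhase_le hx hs (by linarith)
  rw [hset, ← Real.sqrt_eq_rpow, mul_div_assoc]
  refine Real.sqrt_le_iff.mpr ⟨by positivity, hint.trans ?_⟩
  rw [integral_const_mul, integral_Iic_neg_abs_rpow ha hx2, mul_pow, Real.sq_sqrt hKpos.le]
  have hexp : -(1 + 2 * b) + 1 = -(2 * b) := by ring
  have hpow : (t ^ b / x ^ (2 * b)) ^ 2 = (t / x) ^ (2 * b) / x ^ (2 * b) := by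
    rw [Real.div_rpow ht.le hx.le, div_pow, ← Real.rpow_mul_natCast ht.le, Nat.cast_ofNat,
      mul_comm b 2, sq, div_div]
  rw [hexp, neg_div_neg_eq, hpow, Real.rpow_neg hx2.le, Real.div_rpow hx.le two_pos.le, inv_div]
  calc _ ≤ (6 * Real.pi) ^ (2 - 2 * b) * (t / x) ^ (2 * b) *
        (2 ^ (2 * b) / x ^ (2 * b) / (2 * b)) := by gcongr
    _ = _ := by rw [hK]; ring
end
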